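/- arXiv:1012.0399 — 2 statements merged into one kernel-verified Lean document; each statement's English description precedes it below -/
import Mathlib

section
/- σ(h₀) = [0, 2·max(d₁,d₂)] is contained in σ(h), and the set σ(h) \ σ(h₀) is finite and every element of it is an eigenvalue of h (i.e. h has a nonzero eigenvector in ℓ² for that value). -/
open scoped ENNReal

section AbstractPerturbation

variable {E : Type*} [NormedAddCommGroup E] [InnerProductSpace ℂ E]

theorem finite_setOf_neg_eigenvalue_add {T K : E →L[ℂ] E} (hT : T.IsPositive)
    (hK : (K : E →ₗ[ℂ] E).IsSymmetric) [FiniteDimensional ℂ (K : E →ₗ[ℂ] E).range] :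
    {x : ℝ | x < 0 ∧ ∃ f : E, f ≠ 0 ∧ (T + K) f = (x : ℂ) • f}.Finite := by
  by_contra hinf
  obtain ⟨t, ht, hcard⟩ :=
    Set.Infinite.exists_subset_card_eq hinf (Module.finrank ℂ (K : E →ₗ[ℂ] E).range + 1)
  have hex : ∀ i : t, ∃ f : E, ‖f‖ = 1 ∧ (T + K) f = ((i : ℝ) : ℂ) • f := by
    intro i
    obtain ⟨-, f, hf, hfe⟩ := ht i.2
    refine ⟨((‖f‖ : ℂ)⁻¹) • f, ?_, ?_⟩
    · rw [norm_smul, norm_inv, Complex.norm_real, norm_norm,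
        inv_mul_cancel₀ (norm_ne_zero_iff.2 hf)]
    · rw [map_smul, hfe, smul_comm]
  choose e he1 hee using hex
  have hsymm : ((T + K : E →L[ℂ] E) : E →ₗ[ℂ] E).IsSymmetric := hT.isSymmetric.add hK
  have hon : Orthonormal ℂ e := by
    refine ⟨he1, fun i j hij => ?_⟩
    have h := hsymm (e i) (e j)
    simp only [ContinuousLinearMap.coe_coe, hee, inner_smul_left, inner_smul_right,
      Complex.conj_ofReal] at h
    have hne : ((i : ℝ) : ℂ) - ((j : ℝ) : ℂ) ≠ 0 := by
      rw [sub_ne_zero]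
      exact fun h' => hij (Subtype.ext (Complex.ofReal_injective h'))
    exact (mul_eq_zero.1 (by linear_combination h :
      (((i : ℝ) : ℂ) - ((j : ℝ) : ℂ)) * inner ℂ (e i) (e j) = 0)).resolve_left hne
  let Φ : (t → ℂ) →ₗ[ℂ] (K : E →ₗ[ℂ] E).range :=
    (K : E →ₗ[ℂ] E).rangeRestrict ∘ₗ Fintype.linearCombination ℂ e
  have hker : Φ.ker ≠ ⊥ := LinearMap.ker_ne_bot_of_finrank_lt (by simp [hcard])
  obtain ⟨c, hc, hc0⟩ := (Submodule.ne_bot_iff _).1 hker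
  set f : E := ∑ i, c i • e i with hf
  have hKf : K f = 0 := by
    have h := congrArg Subtype.val (LinearMap.mem_ker.1 hc)
    simpa [Φ, Fintype.linearCombination_apply, hf] using h
  have hTf : T f = ∑ i : t, (((i : ℝ) : ℂ) * c i) • e i := by
    have h : T f = (T + K) f := by simp [hKf]
    rw [h, hf, map_sum]
    refine Finset.sum_congr rfl fun i _ => ?_
    rw [map_smul, hee, smul_smul, mul_comm]
  have hpos : 0 ≤ RCLike.re (inner ℂ (T f) f) := hT.2 f
  rw [hTf, hf, hon.inner_sum, map_sum] at hpos
  have hterm : ∀ i : t, RCLike.re ((starRingEnd ℂ) (((i : ℝ) : ℂ) * c i) * c i)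
      = (i : ℝ) * Complex.normSq (c i) := by
    intro i
    rw [map_mul (starRingEnd ℂ), Complex.conj_ofReal, mul_assoc,
      mul_comm (starRingEnd ℂ (c i)), Complex.mul_conj, ← Complex.ofReal_mul]
    rfl
  simp only [hterm] at hpos
  refine hpos.not_gt (Finset.sum_neg' (fun i _ => ?_) ?_)
  · exact mul_nonpos_of_nonpos_of_nonneg (ht i.2).1.le (Complex.normSq_nonneg _)
  · obtain ⟨i, hi⟩ := Function.ne_iff.1 hc0
    exact ⟨i, Finset.mem_univ _, mul_neg_of_neg_of_pos (ht i.2).1 (Complex.normSq_pos.2 hi)⟩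

theorem exists_eigenvector_of_mem_spectrum_add [CompleteSpace E] {T K : E →L[ℂ] E}
    [FiniteDimensional ℂ (K : E →ₗ[ℂ] E).range] {z : ℂ}
    (hz : z ∈ spectrum ℂ (T + K)) (hz' : z ∉ spectrum ℂ T) :
    ∃ f : E, f ≠ 0 ∧ (T + K) f = z • f := by
  rw [spectrum.notMem_iff] at hz'
  obtain ⟨u, hu⟩ := hz'
  have hKc : IsCompactOperator K := by
    have : ProperSpace (K : E →ₗ[ℂ] E).range := FiniteDimensional.proper ℂ _
    let K' : E →L[ℂ] (K : E →ₗ[ℂ] E).range := K.codRestrict _ fun x => ⟨x, rfl⟩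
    exact (isCompactOperator_of_locallyCompactSpace_dom K').clm_comp
      (K : E →ₗ[ℂ] E).range.subtypeL
  have hC : IsCompactOperator ((↑u⁻¹ : E →L[ℂ] E) * K) := hKc.clm_comp (↑u⁻¹ : E →L[ℂ] E)
  rcases hC.hasEigenvalue_or_mem_resolventSet (one_ne_zero (α := ℂ)) with h | h
  · obtain ⟨f, hf⟩ := h.exists_hasEigenvector
    refine ⟨f, hf.2, ?_⟩
    have h1 : (↑u⁻¹ : E →L[ℂ] E) (K f) = f := by simpa using hf.apply_eq_smul
    have h2 : (u : E →L[ℂ] E) ((↑u⁻¹ : E →L[ℂ] E) (K f)) = K f := by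
      rw [← mul_apply_eq_comp, Units.mul_inv]; rfl
    rw [h1, hu] at h2
    simp only [_root_.sub_apply, Algebra.algebraMap_eq_smul_one,
      _root_.smul_apply, one_apply_eq_self] at h2
    rw [_root_.add_apply, ← h2]
    abel
  · exfalso
    rw [spectrum.mem_resolventSet_iff, map_one] at h
    refine hz ?_
    rw [spectrum.mem_resolventSet_iff]
    have : algebraMap ℂ (E →L[ℂ] E) z - (T + K) = u * (1 - ↑u⁻¹ * K) := by
      rw [mul_sub, Units.mul_inv_cancel_left, hu]
      noncomm_ring
    rw [this]
    exact u.isUnit.mul h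

theorem mem_spectrum_of_approx_eigenvector {T : E →L[ℂ] E} {z : ℂ}
    (h : ∀ ε : ℝ, 0 < ε → ∃ f : E, f ≠ 0 ∧ ‖T f - z • f‖ ≤ ε * ‖f‖) :
    z ∈ spectrum ℂ T := by
  rintro ⟨u, hu⟩
  have hC : 0 < ‖(↑u⁻¹ : E →L[ℂ] E)‖ + 1 := by positivity
  obtain ⟨f, hf, hle⟩ := h (1 / (2 * (‖(↑u⁻¹ : E →L[ℂ] E)‖ + 1))) (by positivity)
  have h1 : (↑u⁻¹ : E →L[ℂ] E) ((u : E →L[ℂ] E) f) = f := by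
    rw [← mul_apply_eq_comp, Units.inv_mul]; rfl
  have h2 : (u : E →L[ℂ] E) f = z • f - T f := by
    rw [hu]; simp [Algebra.algebraMap_eq_smul_one]
  have hpos : 0 < ‖f‖ := norm_pos_iff.2 hf
  have h3 : ‖f‖ ≤ ‖(↑u⁻¹ : E →L[ℂ] E)‖ * ‖T f - z • f‖ := by
    conv_lhs => rw [← h1, h2]
    rw [norm_sub_rev (T f)]
    exact ContinuousLinearMap.le_opNorm _ _
  have h4 : ‖f‖ ≤ (‖(↑u⁻¹ : E →L[ℂ] E)‖ + 1) *
      (1 / (2 * (‖(↑u⁻¹ : E →L[ℂ] E)‖ + 1)) * ‖f‖) :=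
    h3.trans (mul_le_mul (by linarith) hle (norm_nonneg _) hC.le)
  have h5 : (‖(↑u⁻¹ : E →L[ℂ] E)‖ + 1) *
      (1 / (2 * (‖(↑u⁻¹ : E →L[ℂ] E)‖ + 1)) * ‖f‖) = ‖f‖ / 2 := by
    field_simp
  linarith

end AbstractPerturbation

section SquareSummable

variable {ι : Type*}

theorem hasSum_norm_sq_lp_two (f : lp (fun _ : ι => ℂ) 2) :
    HasSum (fun x => ‖f x‖ ^ 2) (‖f‖ ^ 2) := by
  have h := lp.hasSum_norm (p := 2) (by norm_num) f
  simpa using h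

theorem memℓp_two_iff_summable_norm_sq {f : ι → ℂ} :
    Memℓp (E := fun _ : ι => ℂ) f 2 ↔ Summable fun x => ‖f x‖ ^ 2 := by
  rw [memℓp_gen_iff (by norm_num)]
  simp

theorem norm_sq_eq_sum_of_support_subset {f : lp (fun _ : ι => ℂ) 2} {S : Finset ι}
    (h : ∀ x ∉ S, f x = 0) : ‖f‖ ^ 2 = ∑ x ∈ S, ‖f x‖ ^ 2 :=
  (hasSum_norm_sq_lp_two f).unique (hasSum_sum_of_ne_finset_zero fun x hx => by simp [h x hx])

theorem inner_eq_sum_of_support_subset {f : lp (fun _ : ι => ℂ) 2} {S : Finset ι}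
    (h : ∀ x ∉ S, f x = 0) (g : lp (fun _ : ι => ℂ) 2) :
    inner ℂ f g = ∑ x ∈ S, (starRingEnd ℂ) (f x) * g x := by
  rw [lp.inner_eq_tsum, tsum_eq_sum (s := S) fun x hx => by simp [h x hx]]
  exact Finset.sum_congr rfl fun x _ => by rw [RCLike.inner_apply, mul_comm]

theorem re_inner_nonneg_of_mul {f g : lp (fun _ : ι => ℂ) 2} {c : ι → ℝ} (hc : ∀ x, 0 ≤ c x)
    (h : ∀ x, g x = (c x : ℂ) * f x) : 0 ≤ RCLike.re (inner ℂ g f) := by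
  have hs := (RCLike.reCLM (K := ℂ)).hasSum (lp.hasSum_inner g f)
  refine hs.nonneg fun x => ?_
  have : (inner ℂ (g x) (f x) : ℂ) = ((c x * Complex.normSq (f x) : ℝ) : ℂ) := by
    rw [h, RCLike.inner_apply, map_mul, Complex.conj_ofReal, Complex.ofReal_mul,
      ← Complex.mul_conj]
    ring
  simp only [this]
  exact mul_nonneg (hc x) (Complex.normSq_nonneg _)

/-- The isometry `f ↦ s · (f ∘ e)` of `ℓ²` given by a permutation `e` of the index set and a
unimodular weight `s`. -/
def weightedShift (e : Equiv.Perm ι) (s : ι → ℂ) (hs : ∀ x, ‖s x‖ = 1) :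
    lp (fun _ : ι => ℂ) 2 →ₗᵢ[ℂ] lp (fun _ : ι => ℂ) 2 where
  toFun f := ⟨fun x => s x * f (e x), memℓp_two_iff_summable_norm_sq.2 (by
    simpa [hs, Function.comp_def] using (e.summable_iff (f := fun x => ‖f x‖ ^ 2)).2
      (hasSum_norm_sq_lp_two f).summable)⟩
  map_add' f g := by ext x; exact mul_add _ _ _
  map_smul' c f := by ext x; exact mul_left_comm _ _ _
  norm_map' f := by
    refine (sq_eq_sq₀ (norm_nonneg _) (norm_nonneg _)).1 ?_
    refine (hasSum_norm_sq_lp_two _).unique ?_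
    have := (e.hasSum_iff (f := fun x => ‖f x‖ ^ 2)).2 (hasSum_norm_sq_lp_two f)
    simpa [hs, Function.comp_def] using this

@[simp]
theorem weightedShift_apply (e : Equiv.Perm ι) (s : ι → ℂ) (hs : ∀ x, ‖s x‖ = 1)
    (f : lp (fun _ : ι => ℂ) 2) (x : ι) : weightedShift e s hs f x = s x * f (e x) :=
  rfl

/-- The isometry `f ↦ f ∘ e` of `ℓ²` given by a permutation `e` of the index set. -/
def permShift (e : Equiv.Perm ι) : lp (fun _ : ι => ℂ) 2 →ₗᵢ[ℂ] lp (fun _ : ι => ℂ) 2 :=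
  weightedShift e (fun _ => 1) fun _ => norm_one

@[simp]
theorem permShift_apply (e : Equiv.Perm ι) (f : lp (fun _ : ι => ℂ) 2) (x : ι) :
    permShift e f x = f (e x) := by
  simp [permShift]

theorem permShift_permShift_symm (e : Equiv.Perm ι) (f : lp (fun _ : ι => ℂ) 2) :
    permShift e (permShift e.symm f) = f := by
  ext x; simp

theorem inner_permShift_left (e : Equiv.Perm ι) (f g : lp (fun _ : ι => ℂ) 2) :
    inner ℂ (permShift e f) g = inner ℂ f (permShift e.symm g) := by
  rw [lp.inner_eq_tsum, lp.inner_eq_tsum,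
    ← e.tsum_eq fun x => inner ℂ (f x) (permShift e.symm g x)]
  simp

theorem abs_re_inner_isometry_le {E : Type*} [NormedAddCommGroup E] [InnerProductSpace ℂ E]
    (W : E →ₗᵢ[ℂ] E) (f : E) : |RCLike.re (inner ℂ (W f) f)| ≤ ‖f‖ ^ 2 := by
  refine (RCLike.abs_re_le_norm _).trans ((norm_inner_le_norm _ _).trans ?_)
  rw [W.norm_map, sq]

theorem finiteDimensional_range_of_support_subset
    {K : lp (fun _ : ι => ℂ) 2 →L[ℂ] lp (fun _ : ι => ℂ) 2} {S : Finset ι}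
    (h : ∀ f, ∀ x ∉ S, K f x = 0) :
    FiniteDimensional ℂ
      (K : lp (fun _ : ι => ℂ) 2 →ₗ[ℂ] lp (fun _ : ι => ℂ) 2).range := by
  let φ : (K : lp (fun _ : ι => ℂ) 2 →ₗ[ℂ] lp (fun _ : ι => ℂ) 2).range →ₗ[ℂ] (S → ℂ) :=
    { toFun := fun f x => f.1 x
      map_add' := fun f g => by ext x; simp
      map_smul' := fun c f => by ext x; simp }
  refine FiniteDimensional.of_injective φ ((injective_iff_map_eq_zero φ).2 ?_)
  rintro ⟨_, f, rfl⟩ hf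
  refine Subtype.ext (lp.ext (funext fun x => ?_))
  by_cases hx : x ∈ S
  · exact congrFun hf ⟨x, hx⟩
  · exact h f x hx

end SquareSummable

section WeylSequence

/-- The cube of side `n` in `ℤ^d` with lowest corner `(M, …, M)`. -/
noncomputable def latticeCube (d : ℕ) (M : ℤ) (n : ℕ) : Finset (Fin d → ℤ) :=
  Fintype.piFinset fun _ => Finset.Ico M (M + n)

theorem mem_latticeCube {d : ℕ} {M : ℤ} {n : ℕ} {x : Fin d → ℤ} :
    x ∈ latticeCube d M n ↔ ∀ i, M ≤ x i ∧ x i < M + n := by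
  simp [latticeCube]

theorem card_latticeCube (d : ℕ) (M : ℤ) (n : ℕ) : (latticeCube d M n).card = n ^ d := by
  simp [latticeCube]

/-- The two layers of `ℤ^d` where the indicator of a cube differs from its shift in the
direction `α`. -/
noncomputable def cubeFaces (d : ℕ) (M : ℤ) (n : ℕ) (α : Fin d) : Finset (Fin d → ℤ) :=
  Fintype.piFinset (Function.update (fun _ => Finset.Ico M (M + n)) α {M - 1}) ∪
    Fintype.piFinset (Function.update (fun _ => Finset.Ico M (M + n)) α {M + n - 1})

theorem card_cubeFaces_le (d : ℕ) (M : ℤ) (n : ℕ) (α : Fin d) :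
    (cubeFaces d M n α).card ≤ 2 * n ^ (d - 1) := by
  have key : ∀ a : ℤ, (Fintype.piFinset
      (Function.update (fun _ : Fin d => Finset.Ico M (M + n)) α {a})).card = n ^ (d - 1) := by
    intro a
    rw [Fintype.card_piFinset, ← Finset.mul_prod_erase _ _ (Finset.mem_univ α),
      Function.update_self, Finset.card_singleton, one_mul]
    rw [Finset.prod_congr rfl fun i hi => by
      rw [Function.update_of_ne (Finset.ne_of_mem_erase hi)]]
    simp
  refine (Finset.card_union_le _ _).trans ?_
  rw [key, key, two_mul]

theorem mem_latticeCube_add_single_iff {d : ℕ} {M : ℤ} {n : ℕ} {α : Fin d} {x : Fin d → ℤ}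
    (hx : x ∉ cubeFaces d M n α) :
    x + Pi.single α 1 ∈ latticeCube d M n ↔ x ∈ latticeCube d M n := by
  simp only [cubeFaces, Finset.mem_union, Fintype.mem_piFinset, not_or] at hx
  obtain ⟨h1, h2⟩ := hx
  rw [mem_latticeCube, mem_latticeCube]
  have aux : ∀ a : ℤ, (∀ i ≠ α, M ≤ x i ∧ x i < M + n) → x α = a → ∀ i,
      x i ∈ Function.update (fun _ : Fin d => Finset.Ico M (M + n)) α {a} i := by
    intro a h h' i
    by_cases hi : i = α
    · subst hi; simp [h']
    · simpa [Function.update_of_ne hi] using h i hi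
  constructor
  · intro h
    have h0 : ∀ i ≠ α, M ≤ x i ∧ x i < M + n := fun i hi => by
      simpa [Pi.single_eq_of_ne hi] using h i
    have h3 := h α
    have h4 : x α ≠ M - 1 := fun h' => h1 (aux _ h0 h')
    simp only [Pi.add_apply, Pi.single_eq_same] at h3
    intro i
    by_cases hi : i = α
    · subst hi; omega
    · exact h0 i hi
  · intro h
    have h4 : x α ≠ M + n - 1 := fun h' => h2 (aux _ (fun i _ => h i) h')
    intro i
    by_cases hi : i = α
    · subst hi
      have := h i
      simp only [Pi.add_apply, Pi.single_eq_same]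
      omega
    · simpa [Pi.single_eq_of_ne hi] using h i

theorem exists_latticeCube_disjoint {d : ℕ} (hd : 1 ≤ d) (S : Finset (Fin d → ℤ)) :
    ∃ M : ℤ, ∀ n, ∀ x ∈ S, x ∉ latticeCube d M n := by
  obtain ⟨M, hM⟩ := (S.image fun x => x ⟨0, hd⟩).bddAbove
  refine ⟨M + 1, fun n x hx h => ?_⟩
  have h1 := hM (Finset.mem_coe.2 (Finset.mem_image_of_mem (fun x => x ⟨0, hd⟩) hx))
  have h2 := (mem_latticeCube.1 h ⟨0, hd⟩).1
  omega

theorem exists_approx_planeWave {ι : Type*} {d : ℕ} (hd : 1 ≤ d) (j : (Fin d → ℤ) ↪ ι)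
    (e : Fin d → Equiv.Perm ι) (he : ∀ α x, e α (j x) = j (x + Pi.single α 1))
    {z : ℂ} (hz : ‖z‖ = 1) (S : Finset (Fin d → ℤ)) {ε : ℝ} (hε : 0 < ε) :
    ∃ F : lp (fun _ : ι => ℂ) 2, F ≠ 0 ∧ (∀ x ∈ S, F (j x) = 0) ∧
      (∀ y ∉ Set.range j, F y = 0) ∧ ∀ α, ‖permShift (e α) F - z • F‖ ≤ ε * ‖F‖ := by
  classical
  obtain ⟨M, hM⟩ := exists_latticeCube_disjoint hd S
  obtain ⟨n, hn⟩ := exists_nat_gt (2 / ε ^ 2)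
  have hn0 : (0 : ℝ) < n := lt_trans (by positivity) hn
  have hz0 : z ≠ 0 := norm_ne_zero_iff.1 (by rw [hz]; exact one_ne_zero)
  let w : ι → ℂ := Function.extend j
    (fun x => if x ∈ latticeCube d M n then z ^ (∑ i, x i) else 0) 0
  have hwj : ∀ x, w (j x) = if x ∈ latticeCube d M n then z ^ (∑ i, x i) else 0 := fun x =>
    j.injective.extend_apply _ _ _
  have hw0 : ∀ y ∉ Set.range j, w y = 0 := fun y hy => Function.extend_apply' _ _ _ hy
  have hws : ∀ y ∉ (latticeCube d M n).map j, w y = 0 := by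
    intro y hy
    by_cases hyj : y ∈ Set.range j
    · obtain ⟨x, rfl⟩ := hyj
      rw [hwj, if_neg]
      simpa using hy
    · exact hw0 y hyj
  let F : lp (fun _ : ι => ℂ) 2 := ⟨w, memℓp_two_iff_summable_norm_sq.2
    (summable_of_ne_finset_zero (s := (latticeCube d M n).map j) fun y hy => by simp [hws y hy])⟩
  have hF : ∀ y, F y = w y := fun _ => rfl
  have hFn : ‖F‖ ^ 2 = (n : ℝ) ^ d := by
    rw [norm_sq_eq_sum_of_support_subset hws, Finset.sum_map,
      Finset.sum_congr rfl fun x hx => by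
        rw [hF, hwj, if_pos hx, norm_zpow, hz, one_zpow, one_pow]]
    simp [card_latticeCube]
  refine ⟨F, ?_, fun x hx => ?_, hw0, fun α => ?_⟩
  · rintro h
    rw [h, norm_zero] at hFn
    have : (0 : ℝ) < (n : ℝ) ^ d := by positivity
    rw [← hFn] at this
    norm_num at this
  · rw [hF, hwj, if_neg (hM n x hx)]
  · have hval : ∀ x, (permShift (e α) F - z • F) (j x) =
        (if x + Pi.single α 1 ∈ latticeCube d M n then z ^ (∑ i, x i + 1) else 0) -
          (if x ∈ latticeCube d M n then z ^ (∑ i, x i + 1) else 0) := by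
      intro x
      simp only [lp.coeFn_sub, lp.coeFn_smul, Pi.sub_apply, Pi.smul_apply, permShift_apply, hF,
        he, hwj, Pi.add_apply, Finset.sum_add_distrib, Finset.sum_pi_single', Finset.mem_univ,
        if_true, smul_eq_mul, zpow_add_one₀ hz0, mul_comm z, ite_mul, zero_mul]
    have hsupp : ∀ y ∉ (cubeFaces d M n α).map j, (permShift (e α) F - z • F) y = 0 := by
      intro y hy
      by_cases hyj : y ∈ Set.range j
      · obtain ⟨x, rfl⟩ := hyj
        have hx : x ∉ cubeFaces d M n α := by simpa using hy
        rw [hval]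
        simp only [mem_latticeCube_add_single_iff hx, sub_self]
      · have hyj' : e α y ∉ Set.range j := by
          rintro ⟨x, hx⟩
          refine hyj ⟨x - Pi.single α 1, (e α).injective ?_⟩
          rw [he, sub_add_cancel, hx]
        rw [lp.coeFn_sub, lp.coeFn_smul, Pi.sub_apply, Pi.smul_apply, permShift_apply, hF, hF,
          hw0 _ hyj, hw0 _ hyj', smul_zero, sub_zero]
    have hle : ‖permShift (e α) F - z • F‖ ^ 2 ≤ 2 * (n : ℝ) ^ (d - 1) := by
      rw [norm_sq_eq_sum_of_support_subset hsupp, Finset.sum_map]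
      calc ∑ x ∈ cubeFaces d M n α, ‖(permShift (e α) F - z • F) (j x)‖ ^ 2
          ≤ ∑ x ∈ cubeFaces d M n α, (1 : ℝ) := by
            refine Finset.sum_le_sum fun x _ => pow_le_one₀ (norm_nonneg _) ?_
            rw [hval]
            split_ifs <;> simp [hz]
        _ = (cubeFaces d M n α).card := by simp
        _ ≤ 2 * (n : ℝ) ^ (d - 1) := by exact_mod_cast card_cubeFaces_le d M n α
    refine abs_le_of_sq_le_sq' ?_ (by positivity) |>.2
    refine hle.trans ?_
    rw [mul_pow, hFn]
    have hd' : (n : ℝ) ^ d = n * (n : ℝ) ^ (d - 1) := by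
      rw [← pow_succ', Nat.sub_add_cancel hd]
    rw [hd', ← mul_assoc]
    refine mul_le_mul_of_nonneg_right ?_ (by positivity)
    rw [div_lt_iff₀ (by positivity)] at hn
    linarith

end WeylSequence

section Hopping

variable {ι : Type*}

/-- The operator `f ↦ ∑ i, (f - (U_i f + U_i⁻¹ f) / 2)`, where `U_i f = f ∘ e i`. -/
noncomputable def hopping {κ : Type*} [Fintype κ] (e : κ → Equiv.Perm ι)
    (f : lp (fun _ : ι => ℂ) 2) : lp (fun _ : ι => ℂ) 2 :=
  ∑ i, (f - (1 / 2 : ℂ) • (permShift (e i) f + permShift (e i).symm f))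

theorem hopping_apply {κ : Type*} [Fintype κ] (e : κ → Equiv.Perm ι)
    (f : lp (fun _ : ι => ℂ) 2) (x : ι) :
    hopping e f x = ∑ i, (f x - (1 / 2 : ℂ) * (f (e i x) + f ((e i).symm x))) := by
  rw [hopping, lp.coeFn_sum, Finset.sum_apply]
  simp only [lp.coeFn_sub, lp.coeFn_smul, lp.coeFn_add, Pi.sub_apply, Pi.smul_apply,
    Pi.add_apply, permShift_apply, smul_eq_mul]

theorem inner_hopping_left {κ : Type*} [Fintype κ] (e : κ → Equiv.Perm ι)
    (f g : lp (fun _ : ι => ℂ) 2) : inner ℂ (hopping e f) g = inner ℂ f (hopping e g) := by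
  rw [hopping, hopping, sum_inner, inner_sum]
  refine Finset.sum_congr rfl fun i _ => ?_
  simp only [inner_sub_left, inner_sub_right, inner_smul_left, inner_smul_right, inner_add_left,
    inner_add_right, inner_permShift_left, Equiv.symm_symm]
  rw [show (starRingEnd ℂ) (1 / 2 : ℂ) = 1 / 2 by
    simpa using Complex.conj_ofReal (1 / 2 : ℝ)]
  ring

theorem re_inner_sub_half_isometries_nonneg {E : Type*} [NormedAddCommGroup E]
    [InnerProductSpace ℂ E] (W W' : E →ₗᵢ[ℂ] E) (f : E) :
    0 ≤ RCLike.re (inner ℂ (f - (1 / 2 : ℂ) • (W f + W' f)) f) := by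
  have h1 := (abs_le.1 (abs_re_inner_isometry_le W f)).2
  have h2 := (abs_le.1 (abs_re_inner_isometry_le W' f)).2
  have h3 : (inner ℂ f f : ℂ) = ((‖f‖ ^ 2 : ℝ) : ℂ) := by
    simp [inner_self_eq_norm_sq_to_K]
  have h4 : (starRingEnd ℂ) (1 / 2 : ℂ) = ((1 / 2 : ℝ) : ℂ) := by
    simpa using Complex.conj_ofReal (1 / 2 : ℝ)
  rw [inner_sub_left, inner_smul_left, inner_add_left, h3, h4]
  simp only [RCLike.re_to_complex, Complex.sub_re, Complex.re_ofReal_mul, Complex.add_re,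
    Complex.ofReal_re] at h1 h2 ⊢
  linarith

theorem norm_hopping_sub_smul_le {d : ℕ} (e : Fin d → Equiv.Perm ι) (θ δ : ℝ)
    (f : lp (fun _ : ι => ℂ) 2)
    (h : ∀ i, ‖permShift (e i) f - Complex.exp (θ * Complex.I) • f‖ ≤ δ) :
    ‖hopping e f - ((d * (1 - Real.cos θ) : ℝ) : ℂ) • f‖ ≤ d * δ := by
  set z := Complex.exp (θ * Complex.I) with hz
  have hz1 : ‖z‖ = 1 := Complex.norm_exp_ofReal_mul_I θ
  have hz0 : z ≠ 0 := Complex.exp_ne_zero _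
  have hsymm : ∀ i, ‖permShift (e i).symm f - z⁻¹ • f‖ ≤ δ := by
    intro i
    rw [← (permShift (e i)).norm_map, map_sub, map_smul, permShift_permShift_symm]
    have : f - z⁻¹ • permShift (e i) f = -(z⁻¹ • (permShift (e i) f - z • f)) := by
      rw [smul_sub, inv_smul_smul₀ hz0, neg_sub]
    rw [this, norm_neg, norm_smul, norm_inv, hz1, inv_one, one_mul]
    exact h i
  have hcos : z + z⁻¹ = 2 * Real.cos θ := by
    rw [hz, ← Complex.exp_neg, Complex.ofReal_cos, Complex.cos]
    ring_nf
  have hsum : hopping e f - ((d * (1 - Real.cos θ) : ℝ) : ℂ) • f =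
      ∑ i, (-(1 / 2 : ℂ)) •
        ((permShift (e i) f - z • f) + (permShift (e i).symm f - z⁻¹ • f)) := by
    have : ((d * (1 - Real.cos θ) : ℝ) : ℂ) • f
        = ∑ _i : Fin d, (1 - (1 / 2 : ℂ) * (z + z⁻¹)) • f := by
      rw [Finset.sum_const, Finset.card_univ, Fintype.card_fin, ← Nat.cast_smul_eq_nsmul ℂ,
        smul_smul, hcos]
      push_cast
      ring_nf
    rw [this, hopping, ← Finset.sum_sub_distrib]
    refine Finset.sum_congr rfl fun i _ => ?_
    module
  rw [hsum]
  refine (norm_sum_le _ _).trans ((Finset.sum_le_card_nsmul _ _ δ fun i _ => ?_).trans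
    (by simp))
  rw [norm_smul]
  have h1 : ‖(-(1 / 2 : ℂ))‖ = 1 / 2 := by simp
  have h2 := norm_add_le (permShift (e i) f - z • f) (permShift (e i).symm f - z⁻¹ • f)
  rw [h1]
  linarith [h i, hsymm i]

theorem ofReal_mem_spectrum_of_eq_hopping {d : ℕ} (hd : 1 ≤ d) (j : (Fin d → ℤ) ↪ ι)
    (e : Fin d → Equiv.Perm ι) (he : ∀ α x, e α (j x) = j (x + Pi.single α 1))
    (S : Finset (Fin d → ℤ)) {T : lp (fun _ : ι => ℂ) 2 →L[ℂ] lp (fun _ : ι => ℂ) 2}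
    (hT : ∀ f : lp (fun _ : ι => ℂ) 2, (∀ x ∈ S, f (j x) = 0) →
      (∀ y ∉ Set.range j, f y = 0) → T f = hopping e f)
    {x : ℝ} (hx : x ∈ Set.Icc (0 : ℝ) (2 * d)) : (x : ℂ) ∈ spectrum ℂ T := by
  have hd0 : (0 : ℝ) < d := by exact_mod_cast hd
  have hcos : d * (1 - Real.cos (Real.arccos (1 - x / d))) = x := by
    have h1 : 0 ≤ x / d := div_nonneg hx.1 hd0.le
    have h2 : x / d ≤ 2 := (div_le_iff₀ hd0).2 hx.2
    rw [Real.cos_arccos (by linarith) (by linarith)]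
    field_simp
    ring
  refine mem_spectrum_of_approx_eigenvector fun ε hε => ?_
  obtain ⟨F, hF0, hFS, hFj, hF⟩ := exists_approx_planeWave hd j e he
    (Complex.norm_exp_ofReal_mul_I (Real.arccos (1 - x / d))) S (div_pos hε hd0)
  refine ⟨F, hF0, ?_⟩
  have h := norm_hopping_sub_smul_le e _ _ F hF
  rw [hcos, ← hT F hFS hFj] at h
  refine h.trans (le_of_eq ?_)
  field_simp

end Hopping

section TwoReservoirs

variable {d₁ d₂ : ℕ}

/-- The unit translations of `ℤ^{d₁}` and of `ℤ^{d₂}`, each acting as the identity on the other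
lattice. -/
def latticeShift (d₁ d₂ : ℕ) : Fin d₁ ⊕ Fin d₂ → Equiv.Perm ((Fin d₁ → ℤ) ⊕ (Fin d₂ → ℤ))
  | Sum.inl α => Equiv.sumCongr (Equiv.addRight (Pi.single α 1)) (Equiv.refl _)
  | Sum.inr β => Equiv.sumCongr (Equiv.refl _) (Equiv.addRight (Pi.single β 1))

theorem add_single_eq_update {κ : Type*} [DecidableEq κ] (x : κ → ℤ) (i : κ) (a : ℤ) :
    x + Pi.single i a = Function.update x i (x i + a) := by
  ext k
  by_cases hk : k = i
  · subst hk; simp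
  · simp [hk]

theorem add_neg_single_eq_update {κ : Type*} [DecidableEq κ] (x : κ → ℤ) (i : κ) (a : ℤ) :
    x + -Pi.single i a = Function.update x i (x i - a) := by
  rw [← Pi.single_neg, add_single_eq_update, sub_eq_add_neg]

theorem hopping_latticeShift_inl (f : lp (fun _ : (Fin d₁ → ℤ) ⊕ (Fin d₂ → ℤ) => ℂ) 2)
    (x : Fin d₁ → ℤ) : hopping (latticeShift d₁ d₂) f (Sum.inl x) = -(1 / 2 : ℂ) * ∑ α : Fin d₁,
      ((f (Sum.inl (Function.update x α (x α + 1))) - f (Sum.inl x)) +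
        (f (Sum.inl (Function.update x α (x α - 1))) - f (Sum.inl x))) := by
  rw [hopping_apply, Fintype.sum_sum_type, Finset.mul_sum]
  simp only [latticeShift, Equiv.sumCongr_symm, Equiv.sumCongr_apply, Sum.map_inl,
    Equiv.coe_addRight, Equiv.addRight_symm, Equiv.refl_symm, Equiv.refl_apply,
    add_single_eq_update, add_neg_single_eq_update]
  rw [Finset.sum_eq_zero (s := (Finset.univ : Finset (Fin d₂))) fun _ _ => by ring, add_zero]
  exact Finset.sum_congr rfl fun _ _ => by ring

theorem hopping_latticeShift_inr (f : lp (fun _ : (Fin d₁ → ℤ) ⊕ (Fin d₂ → ℤ) => ℂ) 2)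
    (x : Fin d₂ → ℤ) : hopping (latticeShift d₁ d₂) f (Sum.inr x) = -(1 / 2 : ℂ) * ∑ α : Fin d₂,
      ((f (Sum.inr (Function.update x α (x α + 1))) - f (Sum.inr x)) +
        (f (Sum.inr (Function.update x α (x α - 1))) - f (Sum.inr x))) := by
  rw [hopping_apply, Fintype.sum_sum_type, Finset.mul_sum]
  simp only [latticeShift, Equiv.sumCongr_symm, Equiv.sumCongr_apply, Sum.map_inr,
    Equiv.coe_addRight, Equiv.addRight_symm, Equiv.refl_symm, Equiv.refl_apply,
    add_single_eq_update, add_neg_single_eq_update]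
  rw [Finset.sum_eq_zero (s := (Finset.univ : Finset (Fin d₁))) fun _ _ => by ring, zero_add]
  exact Finset.sum_congr rfl fun _ _ => by ring

theorem hopping_latticeShift_eq_inl {f : lp (fun _ : (Fin d₁ → ℤ) ⊕ (Fin d₂ → ℤ) => ℂ) 2}
    (h : ∀ y, f (Sum.inr y) = 0) :
    hopping (latticeShift d₁ d₂) f = hopping (fun α => latticeShift d₁ d₂ (Sum.inl α)) f := by
  ext x
  rw [hopping_apply, hopping_apply, Fintype.sum_sum_type, add_eq_left]
  refine Finset.sum_eq_zero fun β _ => ?_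
  rcases x with x | y
  · simp only [latticeShift, Equiv.sumCongr_symm, Equiv.sumCongr_apply, Sum.map_inl,
      Equiv.refl_symm, Equiv.refl_apply]
    ring
  · simp [latticeShift, h]

theorem hopping_latticeShift_eq_inr {f : lp (fun _ : (Fin d₁ → ℤ) ⊕ (Fin d₂ → ℤ) => ℂ) 2}
    (h : ∀ x, f (Sum.inl x) = 0) :
    hopping (latticeShift d₁ d₂) f = hopping (fun β => latticeShift d₁ d₂ (Sum.inr β)) f := by
  ext x
  rw [hopping_apply, hopping_apply, Fintype.sum_sum_type, add_eq_right]
  refine Finset.sum_eq_zero fun β _ => ?_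
  rcases x with x | y
  · simp [latticeShift, h]
  · simp only [latticeShift, Equiv.sumCongr_symm, Equiv.sumCongr_apply, Sum.map_inr,
      Equiv.refl_symm, Equiv.refl_apply]
    ring

theorem Icc_subset_spectrum_of_eq_hopping (hd₁ : 1 ≤ d₁) (hd₂ : 1 ≤ d₂)
    (S₁ : Finset (Fin d₁ → ℤ)) (S₂ : Finset (Fin d₂ → ℤ))
    {T : lp (fun _ : (Fin d₁ → ℤ) ⊕ (Fin d₂ → ℤ) => ℂ) 2 →L[ℂ]
      lp (fun _ : (Fin d₁ → ℤ) ⊕ (Fin d₂ → ℤ) => ℂ) 2}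
    (hT : ∀ f : lp (fun _ : (Fin d₁ → ℤ) ⊕ (Fin d₂ → ℤ) => ℂ) 2,
      (∀ x ∈ S₁, f (Sum.inl x) = 0) → (∀ y ∈ S₂, f (Sum.inr y) = 0) →
      T f = hopping (latticeShift d₁ d₂) f) :
    Complex.ofReal '' Set.Icc (0 : ℝ) (2 * (max d₁ d₂ : ℕ)) ⊆ spectrum ℂ T := by
  rintro _ ⟨x, hx, rfl⟩
  rcases max_choice d₁ d₂ with h | h
  · rw [h] at hx
    refine ofReal_mem_spectrum_of_eq_hopping hd₁ Function.Embedding.inl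
      (fun α => latticeShift d₁ d₂ (Sum.inl α)) (fun _ _ => rfl) S₁ (fun f hfS hf => ?_) hx
    have hf' : ∀ y, f (Sum.inr y) = 0 := fun y => hf _ (by simp)
    rw [hT f hfS fun y _ => hf' y, hopping_latticeShift_eq_inl hf']
  · rw [h] at hx
    refine ofReal_mem_spectrum_of_eq_hopping hd₂ Function.Embedding.inr
      (fun α => latticeShift d₁ d₂ (Sum.inr α)) (fun _ _ => rfl) S₂ (fun f hfS hf => ?_) hx
    have hf' : ∀ y, f (Sum.inl y) = 0 := fun y => hf _ (by simp)
    rw [hT f (fun x _ => hf' x) hfS, hopping_latticeShift_eq_inr hf']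

theorem re_inner_hopping_nonneg {ι κ : Type*} [Fintype κ] (e : κ → Equiv.Perm ι)
    (f : lp (fun _ : ι => ℂ) 2) : 0 ≤ RCLike.re (inner ℂ (hopping e f) f) := by
  rw [hopping, sum_inner, map_sum]
  exact Finset.sum_nonneg fun i _ => re_inner_sub_half_isometries_nonneg _ _ f

/-- The weight equal to `-1` on the lattice on which the given translation acts and to `1` on the
other one. -/
def latticeSign (d₁ d₂ : ℕ) : Fin d₁ ⊕ Fin d₂ → (Fin d₁ → ℤ) ⊕ (Fin d₂ → ℤ) → ℂ
  | Sum.inl _, Sum.inl _ => -1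
  | Sum.inl _, Sum.inr _ => 1
  | Sum.inr _, Sum.inl _ => 1
  | Sum.inr _, Sum.inr _ => -1

theorem norm_latticeSign (i : Fin d₁ ⊕ Fin d₂) (x : (Fin d₁ → ℤ) ⊕ (Fin d₂ → ℤ)) :
    ‖latticeSign d₁ d₂ i x‖ = 1 := by
  rcases i with i | i <;> rcases x with x | x <;> simp [latticeSign]

theorem re_inner_smul_sub_hopping_nonneg
    (f : lp (fun _ : (Fin d₁ → ℤ) ⊕ (Fin d₂ → ℤ) => ℂ) 2) :
    0 ≤ RCLike.re (inner ℂ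
      (((2 * (max d₁ d₂ : ℕ) : ℝ) : ℂ) • f - hopping (latticeShift d₁ d₂) f) f) := by
  let B : lp (fun _ : (Fin d₁ → ℤ) ⊕ (Fin d₂ → ℤ) => ℂ) 2 := ∑ i : Fin d₁ ⊕ Fin d₂,
    (f - (1 / 2 : ℂ) •
      (weightedShift (latticeShift d₁ d₂ i) (latticeSign d₁ d₂ i) (norm_latticeSign i) f +
      weightedShift (latticeShift d₁ d₂ i).symm (latticeSign d₁ d₂ i) (norm_latticeSign i) f))
  have hB : 0 ≤ RCLike.re (inner ℂ B f) := by
    simp only [B]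
    rw [sum_inner, map_sum]
    exact Finset.sum_nonneg fun i _ => re_inner_sub_half_isometries_nonneg _ _ f
  have hBx : ∀ x, B x = ∑ i, (f x - (1 / 2 : ℂ) * (latticeSign d₁ d₂ i x *
      f (latticeShift d₁ d₂ i x) +
        latticeSign d₁ d₂ i x * f ((latticeShift d₁ d₂ i).symm x))) := by
    intro x
    simp only [B]
    rw [lp.coeFn_sum, Finset.sum_apply]
    rfl
  have hD := re_inner_nonneg_of_mul (f := f)
    (g := ((2 * (max d₁ d₂ : ℕ) : ℝ) : ℂ) • f - hopping (latticeShift d₁ d₂) f - B)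
    (c := Sum.elim (fun _ => 2 * (max d₁ d₂ : ℕ) - 2 * d₁)
      fun _ => 2 * (max d₁ d₂ : ℕ) - 2 * d₂)
    (by
      rintro (x | y)
      · simp
      · simp)
    (by
      intro x
      have hcoe : (((2 * (max d₁ d₂ : ℕ) : ℝ) : ℂ) • f - hopping (latticeShift d₁ d₂) f - B) x =
          ((2 * (max d₁ d₂ : ℕ) : ℝ) : ℂ) * f x - (hopping (latticeShift d₁ d₂) f x + B x) := by
        rw [← sub_sub]; rfl
      rw [hcoe, hopping_apply, hBx, ← Finset.sum_add_distrib, Fintype.sum_sum_type]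
      rcases x with x | y
      · rw [Finset.sum_congr rfl fun (i : Fin d₁) _ => show _ = 2 * f (Sum.inl x) by
            simp only [latticeSign]; ring,
          Finset.sum_eq_zero (s := (Finset.univ : Finset (Fin d₂))) fun i _ => by
            simp only [latticeSign, latticeShift, Equiv.sumCongr_symm, Equiv.sumCongr_apply,
              Sum.map_inl, Equiv.refl_symm, Equiv.refl_apply]
            ring]
        simp
        ring
      · rw [Finset.sum_congr (s₁ := (Finset.univ : Finset (Fin d₂))) rfl
            fun (i : Fin d₂) _ => show _ = 2 * f (Sum.inr y) by
            simp only [latticeSign]; ring,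
          Finset.sum_eq_zero (s := (Finset.univ : Finset (Fin d₁))) fun i _ => by
            simp only [latticeSign, latticeShift, Equiv.sumCongr_symm, Equiv.sumCongr_apply,
              Sum.map_inr, Equiv.refl_symm, Equiv.refl_apply]
            ring]
        simp
        ring)
  rw [inner_sub_left, map_sub] at hD
  linarith

end TwoReservoirs

section SpectralBounds

variable {E : Type*} [NormedAddCommGroup E] [InnerProductSpace ℂ E] [CompleteSpace E]

theorem mem_spectrum_re_mem_Icc {T : E →L[ℂ] E} {m : ℝ} (hT : T.IsPositive)
    (hT' : ((m : ℂ) • (1 : E →L[ℂ] E) - T).IsPositive) {z : ℂ} (hz : z ∈ spectrum ℂ T) :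
    z = z.re ∧ z.re ∈ Set.Icc 0 m := by
  have key : ∀ {A : E →L[ℂ] E}, A.IsPositive →
      ∀ {w : ℂ}, w ∈ spectrum ℂ A → w = w.re ∧ 0 ≤ w.re := by
    intro A hA w hw
    have h1 := hA.isSelfAdjoint.mem_spectrum_eq_re hw
    refine ⟨h1, ?_⟩
    rw [h1] at hw
    exact spectrum_nonneg_of_nonneg ((ContinuousLinearMap.nonneg_iff_isPositive A).2 hA)
      (spectrum.of_algebraMap_mem ℂ hw)
  refine ⟨(key hT hz).1, (key hT hz).2, ?_⟩
  have h2 : (m : ℂ) - z ∈ spectrum ℂ ((m : ℂ) • (1 : E →L[ℂ] E) - T) := by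
    rw [← Algebra.algebraMap_eq_smul_one, ← spectrum.singleton_sub_eq]
    exact Set.sub_mem_sub rfl hz
  simpa using (key hT' h2).2

theorem finite_spectrum_add_diff {T K : E →L[ℂ] E} {m : ℝ} (hT : T.IsPositive)
    (hT' : ((m : ℂ) • (1 : E →L[ℂ] E) - T).IsPositive)
    (hK : (K : E →ₗ[ℂ] E).IsSymmetric) [FiniteDimensional ℂ (K : E →ₗ[ℂ] E).range]
    (hspec : Complex.ofReal '' Set.Icc 0 m ⊆ spectrum ℂ T) :
    (spectrum ℂ (T + K) \ spectrum ℂ T).Finite := by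
  have hKneg : ((-K : E →L[ℂ] E) : E →ₗ[ℂ] E).IsSymmetric := fun x y => by
    simpa using hK x y
  have : FiniteDimensional ℂ ((-K : E →L[ℂ] E) : E →ₗ[ℂ] E).range := by
    have h : ((-K : E →L[ℂ] E) : E →ₗ[ℂ] E).range = (K : E →ₗ[ℂ] E).range := by
      rw [ContinuousLinearMap.toLinearMap_neg, LinearMap.range_neg]
    rw [h]
    infer_instance
  refine (((finite_setOf_neg_eigenvalue_add hT hK).union
    ((finite_setOf_neg_eigenvalue_add hT' hKneg).image fun x => m - x)).image
      Complex.ofReal).subset fun z hz => ?_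
  have hsa : IsSelfAdjoint (T + K) :=
    hT.isSelfAdjoint.add (ContinuousLinearMap.isSelfAdjoint_iff_isSymmetric.2 hK)
  have hzr := hsa.mem_spectrum_eq_re hz.1
  obtain ⟨f, hf, hfe⟩ := exists_eigenvector_of_mem_spectrum_add hz.1 hz.2
  refine ⟨z.re, ?_, hzr.symm⟩
  by_cases h0 : z.re < 0
  · exact Or.inl ⟨h0, f, hf, by rw [← hzr, hfe]⟩
  · have hm : m < z.re := by
      by_contra hm
      exact hz.2 (hspec ⟨z.re, ⟨not_lt.1 h0, not_lt.1 hm⟩, hzr.symm⟩)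
    refine Or.inr ⟨m - z.re, ⟨by linarith, f, hf, ?_⟩, by ring⟩
    have : ((m : ℂ) • (1 : E →L[ℂ] E) - T + -K) f = (m : ℂ) • f - (T + K) f := by
      simp only [_root_.add_apply, _root_.sub_apply, _root_.smul_apply, _root_.neg_apply,
        one_apply_eq_self]
      abel
    rw [this, hfe, Complex.ofReal_sub, ← hzr, sub_smul]

end SpectralBounds

theorem isSymmetric_of_tunneling {ι κ : Type*} {S : Finset ι} {S' : Finset κ} {t : ι → κ → ℝ}
    {v : lp (fun _ : ι ⊕ κ => ℂ) 2 →L[ℂ] lp (fun _ : ι ⊕ κ => ℂ) 2}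
    (hl : ∀ f x, x ∉ S → v f (Sum.inl x) = 0) (hr : ∀ f y, y ∉ S' → v f (Sum.inr y) = 0)
    (hl' : ∀ f, ∀ x ∈ S, v f (Sum.inl x) = ∑ y ∈ S', (t x y : ℂ) * f (Sum.inr y))
    (hr' : ∀ f, ∀ y ∈ S', v f (Sum.inr y) = ∑ x ∈ S, (t x y : ℂ) * f (Sum.inl x)) :
    (v : lp (fun _ : ι ⊕ κ => ℂ) 2 →ₗ[ℂ] lp (fun _ : ι ⊕ κ => ℂ) 2).IsSymmetric := by
  have hsupp : ∀ f, ∀ x ∉ S.disjSum S', v f x = 0 := by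
    rintro f (x | y) hx
    · exact hl f x (by simpa using hx)
    · exact hr f y (by simpa using hx)
  have key : ∀ f g, inner ℂ (v f) g =
      ∑ x ∈ S, ∑ y ∈ S', (t x y : ℂ) * ((starRingEnd ℂ) (f (Sum.inr y)) * g (Sum.inl x)) +
      ∑ x ∈ S, ∑ y ∈ S', (t x y : ℂ) * ((starRingEnd ℂ) (f (Sum.inl x)) * g (Sum.inr y)) := by
    intro f g
    rw [inner_eq_sum_of_support_subset (hsupp f), Finset.sum_disjSum]
    congr 1
    · refine Finset.sum_congr rfl fun x hx => ?_
      rw [hl' f x hx, map_sum, Finset.sum_mul]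
      simp only [map_mul, Complex.conj_ofReal, mul_assoc]
    · rw [Finset.sum_comm]
      refine Finset.sum_congr rfl fun y hy => ?_
      rw [hr' f y hy, map_sum, Finset.sum_mul]
      simp only [map_mul, Complex.conj_ofReal, mul_assoc]
  intro f g
  rw [ContinuousLinearMap.coe_coe, ← inner_conj_symm f, key, key, map_add, add_comm]
  simp only [map_sum, map_mul, Complex.conj_conj, Complex.conj_ofReal, mul_comm]

/-- For the coupled Hamiltonian `h = h₀ + v` of two free lattice fermion reservoirs on
`ℤ^{d₁}` and `ℤ^{d₂}` joined by a finite-rank tunneling junction `v`, the spectrum of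
`h₀` equals `[0, 2 max(d₁,d₂)]` and is contained in the spectrum of `h`, while
`σ(h) \ σ(h₀)` is a finite set consisting of eigenvalues of `h`. -/
theorem spectrum_coupled_hamiltonian (d₁ d₂ : ℕ) (hd₁ : 1 ≤ d₁) (hd₂ : 1 ≤ d₂)
    (h₀ v : lp (fun _ : (Fin d₁ → ℤ) ⊕ (Fin d₂ → ℤ) => ℂ) 2 →L[ℂ]
      lp (fun _ : (Fin d₁ → ℤ) ⊕ (Fin d₂ → ℤ) => ℂ) 2)
    (hh₀₁ : ∀ (f : lp (fun _ : (Fin d₁ → ℤ) ⊕ (Fin d₂ → ℤ) => ℂ) 2) (x : Fin d₁ → ℤ),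
      h₀ f (Sum.inl x) = -(1 / 2 : ℂ) * ∑ α : Fin d₁,
        ((f (Sum.inl (Function.update x α (x α + 1))) - f (Sum.inl x)) +
          (f (Sum.inl (Function.update x α (x α - 1))) - f (Sum.inl x))))
    (hh₀₂ : ∀ (f : lp (fun _ : (Fin d₁ → ℤ) ⊕ (Fin d₂ → ℤ) => ℂ) 2) (x : Fin d₂ → ℤ),
      h₀ f (Sum.inr x) = -(1 / 2 : ℂ) * ∑ α : Fin d₂,
        ((f (Sum.inr (Function.update x α (x α + 1))) - f (Sum.inr x)) +
          (f (Sum.inr (Function.update x α (x α - 1))) - f (Sum.inr x))))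
    (S₁ : Finset (Fin d₁ → ℤ)) (S₂ : Finset (Fin d₂ → ℤ))
    (t : (Fin d₁ → ℤ) → (Fin d₂ → ℤ) → ℝ)
    (hv₁ : ∀ (f : lp (fun _ : (Fin d₁ → ℤ) ⊕ (Fin d₂ → ℤ) => ℂ) 2) (x : Fin d₁ → ℤ),
      v f (Sum.inl x) = if x ∈ S₁ then ∑ y ∈ S₂, (t x y : ℂ) * f (Sum.inr y) else 0)
    (hv₂ : ∀ (f : lp (fun _ : (Fin d₁ → ℤ) ⊕ (Fin d₂ → ℤ) => ℂ) 2) (y : Fin d₂ → ℤ),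
      v f (Sum.inr y) = if y ∈ S₂ then ∑ x ∈ S₁, (t x y : ℂ) * f (Sum.inl x) else 0) :
    spectrum ℂ h₀ = Complex.ofReal '' Set.Icc (0 : ℝ) (2 * max d₁ d₂) ∧
    spectrum ℂ h₀ ⊆ spectrum ℂ (h₀ + v) ∧
    (spectrum ℂ (h₀ + v) \ spectrum ℂ h₀).Finite ∧
    ∀ z ∈ spectrum ℂ (h₀ + v) \ spectrum ℂ h₀,
      ∃ f : lp (fun _ : (Fin d₁ → ℤ) ⊕ (Fin d₂ → ℤ) => ℂ) 2,
        f ≠ 0 ∧ (h₀ + v) f = z • f := by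
  have hhop : ∀ f, h₀ f = hopping (latticeShift d₁ d₂) f := by
    intro f
    ext x
    rcases x with x | x
    · rw [hh₀₁, hopping_latticeShift_inl]
    · rw [hh₀₂, hopping_latticeShift_inr]
  have hpos : h₀.IsPositive := by
    refine ⟨fun f g => ?_, fun f => ?_⟩
    · simp only [ContinuousLinearMap.coe_coe, hhop, inner_hopping_left]
    · rw [ContinuousLinearMap.reApplyInnerSelf_apply, hhop]
      exact re_inner_hopping_nonneg _ f
  have hpos' : (((2 * (max d₁ d₂ : ℕ) : ℝ) : ℂ) • 1 - h₀).IsPositive := by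
    refine ⟨fun f g => ?_, fun f => ?_⟩
    · have h := hpos.isSymmetric f g
      simp only [ContinuousLinearMap.coe_coe] at h
      simp only [ContinuousLinearMap.coe_coe, _root_.sub_apply, _root_.smul_apply,
        one_apply_eq_self, inner_sub_left, inner_sub_right, inner_smul_left, inner_smul_right,
        Complex.conj_ofReal, h]
    · rw [ContinuousLinearMap.reApplyInnerSelf_apply]
      simp only [_root_.sub_apply, _root_.smul_apply, one_apply_eq_self, hhop]
      exact re_inner_smul_sub_hopping_nonneg f
  have hvsymm : (v : lp (fun _ : (Fin d₁ → ℤ) ⊕ (Fin d₂ → ℤ) => ℂ) 2 →ₗ[ℂ]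
      lp (fun _ : (Fin d₁ → ℤ) ⊕ (Fin d₂ → ℤ) => ℂ) 2).IsSymmetric :=
    isSymmetric_of_tunneling (fun f x hx => by rw [hv₁, if_neg hx])
      (fun f y hy => by rw [hv₂, if_neg hy]) (fun f x hx => by rw [hv₁, if_pos hx])
      (fun f y hy => by rw [hv₂, if_pos hy])
  have hvfin : FiniteDimensional ℂ (v : lp (fun _ : (Fin d₁ → ℤ) ⊕ (Fin d₂ → ℤ) => ℂ) 2 →ₗ[ℂ]
      lp (fun _ : (Fin d₁ → ℤ) ⊕ (Fin d₂ → ℤ) => ℂ) 2).range := by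
    refine finiteDimensional_range_of_support_subset (S := S₁.disjSum S₂) ?_
    rintro f (x | y) hx
    · rw [hv₁, if_neg (by simpa using hx)]
    · rw [hv₂, if_neg (by simpa using hx)]
  have hIcc : Complex.ofReal '' Set.Icc (0 : ℝ) (2 * (max d₁ d₂ : ℕ)) ⊆ spectrum ℂ h₀ :=
    Icc_subset_spectrum_of_eq_hopping hd₁ hd₂ ∅ ∅ fun f _ _ => hhop f
  have hspec : spectrum ℂ h₀ = Complex.ofReal '' Set.Icc (0 : ℝ) (2 * (max d₁ d₂ : ℕ)) := by
    refine Set.Subset.antisymm (fun z hz => ?_) hIcc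
    have h := mem_spectrum_re_mem_Icc hpos hpos' hz
    exact ⟨z.re, h.2, h.1.symm⟩
  refine ⟨hspec, ?_, finite_spectrum_add_diff hpos hpos' hvsymm hIcc,
    fun z hz => exists_eigenvector_of_mem_spectrum_add hz.1 hz.2⟩
  rw [hspec]
  refine Icc_subset_spectrum_of_eq_hopping hd₁ hd₂ S₁ S₂ fun f hf₁ hf₂ => ?_
  have hvf : v f = 0 := by
    ext x
    rcases x with x | y
    · rw [hv₁, Finset.sum_eq_zero fun y hy => by rw [hf₂ y hy, mul_zero], ite_self]
      rfl
    · rw [hv₂, Finset.sum_eq_zero fun x hx => by rw [hf₁ x hx, mul_zero], ite_self]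
      rfl
  rw [_root_.add_apply, hvf, add_zero, hhop]
end

section
/- For every θ ∈ ℝ, the shell radius is strictly increasing in the energy: if 0 < e < e' < 2, then K(e, θ) < K(e', θ). -/
open Real

/-- On rays from the origin, cosine is antitone up to absolute argument `π`. -/
theorem cos_mul_le_cos_mul_of_abs_le_pi {a b c : ℝ} (ha : 0 ≤ a) (hab : a ≤ b)
    (hb : |b * c| ≤ Real.pi) : Real.cos (b * c) ≤ Real.cos (a * c) := by
  rw [← Real.cos_abs (b * c), ← Real.cos_abs (a * c)]
  refine Real.cos_le_cos_of_nonneg_of_le_pi (abs_nonneg _) hb ?_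
  rw [abs_mul, abs_mul, abs_of_nonneg ha, abs_of_nonneg (ha.trans hab)]
  gcongr

/-- The shell radius `K(e,θ)` is strictly increasing in the energy `e`. -/
theorem energy_shell_radius_strictMono
    (K : ℝ → ℝ → ℝ)
    (hK : ∀ e ∈ Set.Ioo (0 : ℝ) 2, ∀ θ : ℝ,
      0 < K e θ ∧ |K e θ * Real.cos θ| + |K e θ * Real.sin θ| < Real.pi ∧
        Real.cos (K e θ * Real.cos θ) + Real.cos (K e θ * Real.sin θ) = 2 - e)
    (θ : ℝ) (e e' : ℝ) (h0 : 0 < e) (hee' : e < e') (h2 : e' < 2) :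
    K e θ < K e' θ := by
  obtain ⟨-, hsum, hshell⟩ := hK e ⟨h0, hee'.trans h2⟩ θ
  obtain ⟨hpos', -, hshell'⟩ := hK e' ⟨h0.trans hee', h2⟩ θ
  by_contra! hle
  have hcos := cos_mul_le_cos_mul_of_abs_le_pi (c := Real.cos θ) hpos'.le hle
    (by linarith [abs_nonneg (K e θ * Real.sin θ)])
  have hsin := cos_mul_le_cos_mul_of_abs_le_pi (c := Real.sin θ) hpos'.le hle
    (by linarith [abs_nonneg (K e θ * Real.cos θ)])
  linarith
end
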